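/- arXiv:1002.2797 — 3 statements merged into one kernel-verified Lean document; each statement's English description precedes it below -/
import Mathlib

section
/- Let p be a prime, e ≥ 2, j the smallest positive integer such that e divides p^j + 1, q = p^{2jγ} with γ ≥ 1, f = (q−1)/e, and suppose γ, p, (p^j+1)/e are all odd (so e is even). Let m ≥ 1, Q a nonsingular quadratic form on V = F_q^{2m} with polar form B, and ε ∈ {1,−1} such that ∑_{x∈V} ψ_1(αQ(x)) = ε q^m for every α ∈ F_q^×. Set D = {x ∈ V : Q(x) ∈ C_{e/2}}. Then for every b ∈ V with b ≠ 0: ∑_{x∈D} ψ_1(B(b,x)) = ε q^{m−1}(q−f) if −Q(b) ∈ C_{e/2}, and ∑_{x∈D} ψ_1(B(b,x)) = −ε q^{m−1} f otherwise. -/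
open Finset

noncomputable section
open scoped Classical

/-- `D` is a `(v,k,λ,μ)` partial difference set in the finite abelian group `G`:
every nonzero element of `D` is a difference of elements of `D` in exactly `λ` ways,
and every nonzero element outside `D` in exactly `μ` ways. -/
def IsPDS {G : Type*} [AddCommGroup G] [Fintype G] (D : Finset G) (v k lam mu : ℤ) : Prop :=
  (Fintype.card G : ℤ) = v ∧ (D.card : ℤ) = k ∧
    ∀ g : G, g ≠ 0 →
      ((((D ×ˢ D).filter fun xy => xy.1 - xy.2 = g).card : ℤ) = if g ∈ D then lam else mu)

noncomputable instance (p n : ℕ) [Fact p.Prime] : Fintype (GaloisField p n) :=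
  Fintype.ofFinite _

/-- The canonical additive character `ψ₁(x) = ω_p^{Tr(x)}` of `F_{p^n}`,
where `ω_p = exp(2πi/p)` and `Tr` is the absolute trace. -/
def psi (p n : ℕ) [Fact p.Prime] (x : GaloisField p n) : ℂ :=
  Complex.exp (2 * Real.pi * Complex.I *
    ((Algebra.trace (ZMod p) (GaloisField p n) x).val : ℂ) / p)

/-- The cyclotomic class `C_i = {g^{i+ej} : 0 ≤ j ≤ f-1}` of order `e`
with respect to the primitive element `g`. -/
def cycClass (p n : ℕ) [Fact p.Prime] (g : GaloisField p n) (e f i : ℕ) :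
    Finset (GaloisField p n) :=
  (Finset.range f).image fun j => g ^ (i + e * j)

/-- The polar form `B(x,y) = Q(x+y) − Q(x) − Q(y)` of `Q`. -/
def polarForm {F V : Type*} [Field F] [AddCommGroup V] (Q : V → F) (x y : V) : F :=
  Q (x + y) - Q x - Q y

/-- In a finite field whose order is `1` modulo `n`, there are `n` solutions of `x ^ n = 1`. -/
lemma card_filter_pow_eq_one {F : Type*} [Field F] [Fintype F] {n : ℕ}
    (hn : n ∣ Fintype.card F - 1) :
    #(univ.filter fun x : F => x ^ n = 1) = n := by
  have hpos : 0 < Fintype.card F - 1 := Nat.sub_pos_of_lt Fintype.one_lt_card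
  obtain ⟨k, hk⟩ := hn
  have hn0 : 0 < n := Nat.pos_of_ne_zero (by rintro rfl; simp at hk; omega)
  obtain ⟨u, hu⟩ := IsCyclic.exists_ofOrder_eq_natCard (α := Fˣ)
  rw [Nat.card_eq_fintype_card, Fintype.card_units] at hu
  have hprim : IsPrimitiveRoot (u : F) (Fintype.card F - 1) :=
    IsPrimitiveRoot.coe_units_iff.2 (hu ▸ IsPrimitiveRoot.orderOf u)
  have hz : IsPrimitiveRoot ((u : F) ^ k) n := hprim.pow hpos (by rw [hk, mul_comm])
  have hset : (univ.filter fun x : F => x ^ n = 1) = Polynomial.nthRootsFinset n (1 : F) := by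
    ext x
    simp [Polynomial.mem_nthRootsFinset hn0]
  rw [hset, hz.card_nthRootsFinset]

lemma exists_pow_eq_neg_one {F : Type*} [Field F] [Fintype F] {n : ℕ} (hn0 : 0 < n)
    (hn : n * 2 ∣ Fintype.card F - 1) : ∃ w : F, w ^ n = -1 := by
  by_contra! h
  have hsub : (univ.filter fun x : F => x ^ (n * 2) = 1) ⊆ univ.filter fun x : F => x ^ n = 1 := by
    intro x hx
    simp only [mem_filter, mem_univ, true_and, pow_mul] at hx ⊢
    exact (mul_self_eq_one_iff.1 (by rw [← sq, hx])).resolve_right (h x)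
  have hle := card_le_card hsub
  rw [card_filter_pow_eq_one hn, card_filter_pow_eq_one (dvd_of_mul_right_dvd hn)] at hle
  omega

/-- Multiplication by `z` identifies the solutions of `x ^ n = 1` and of `x ^ n = z ^ n`. -/
lemma sum_pow_eq_pow {F : Type*} [Field F] [Fintype F] {n : ℕ} {z : F} (hz : z ≠ 0)
    (h : F → ℂ) :
    ∑ x ∈ univ.filter (fun x : F => x ^ n = z ^ n), h x
      = ∑ x ∈ univ.filter (fun x : F => x ^ n = 1), h (z * x) := by
  symm
  refine Finset.sum_bij' (fun x _ => z * x) (fun x _ => z⁻¹ * x) ?_ ?_ ?_ ?_ ?_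
  · intro x hx
    simp only [mem_filter, mem_univ, true_and] at hx ⊢
    rw [mul_pow, hx, mul_one]
  · intro x hx
    simp only [mem_filter, mem_univ, true_and] at hx ⊢
    rw [mul_pow, hx, inv_pow, inv_mul_cancel₀ (pow_ne_zero _ hz)]
  · intro x _; field_simp
  · intro x _; field_simp
  · intro x _; rfl

lemma card_filter_pow_eq_pow {F : Type*} [Field F] [Fintype F] {n : ℕ}
    (hn : n ∣ Fintype.card F - 1) {z : F} (hz : z ≠ 0) :
    #(univ.filter fun x : F => x ^ n = z ^ n) = n := by
  have h := sum_pow_eq_pow (n := n) hz (fun _ => (1 : ℂ))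
  simp only [sum_const, nsmul_eq_mul, mul_one] at h
  rw [card_filter_pow_eq_one hn] at h
  exact_mod_cast h

/-- Additive character sums over the nonzero elements of the subfield of order `r` of a field
of order `r ^ 2`. -/
lemma sum_subfield_units {F : Type*} [Field F] [Fintype F] {ψ : AddChar F ℂ}
    (hψ : ψ.IsPrimitive) {r : ℕ} (hr : Odd r) (hr1 : 1 < r) (hcard : Fintype.card F = r ^ 2)
    (hadd : ∀ x y : F, (x + y) ^ r = x ^ r + y ^ r) (hψr : ∀ x, ψ (x ^ r) = ψ x)
    (h2 : (2 : F) ≠ 0) {y : F} (hy : y ≠ 0) :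
    ∑ t ∈ univ.filter (fun t : F => t ^ (r - 1) = 1), ψ (y * t)
      = (if y ^ (r - 1) = -1 then (r : ℂ) else 0) - 1 := by
  have hrr : ∀ x : F, (x ^ r) ^ r = x := fun x => by
    rw [← pow_mul, ← sq, ← hcard, FiniteField.pow_card]
  have hpow : ∀ x : F, x ^ r = x ^ (r - 1) * x := fun x => by
    rw [← pow_succ, Nat.sub_add_cancel hr1.le]
  have hdvd : r - 1 ∣ Fintype.card F - 1 :=
    ⟨r + 1, by rw [hcard, mul_comm, ← Nat.sq_sub_sq, one_pow]⟩
  split_ifs with hy1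
  · have hone : ∀ t ∈ univ.filter (fun t : F => t ^ (r - 1) = 1), ψ (y * t) = 1 := by
      intro t ht
      simp only [mem_filter, mem_univ, true_and] at ht
      have h2r : (2 : F) ^ r = 2 := by
        rw [← one_add_one_eq_two, hadd, one_pow]
      have hz : (y * t / 2) ^ r = -(y * t / 2) := by
        rw [div_pow, mul_pow, hpow y, hpow t, hy1, ht, h2r]; ring
      have hhalves : y * t / 2 + y * t / 2 = y * t := by
        rw [← mul_two, div_mul_cancel₀ _ h2]
      calc ψ (y * t) = ψ (y * t / 2 + y * t / 2) := by rw [hhalves]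
        _ = ψ (y * t / 2) * ψ ((y * t / 2) ^ r) := by rw [AddChar.map_add_eq_mul, hψr]
        _ = 1 := by rw [hz, ← AddChar.map_add_eq_mul, add_neg_cancel, AddChar.map_zero_eq_one]
    rw [sum_congr rfl hone, sum_const, card_filter_pow_eq_one hdvd, nsmul_eq_mul, mul_one,
      Nat.cast_sub hr1.le, Nat.cast_one]
  · have hne : y ^ r + y ≠ 0 := by
      intro h
      apply hy1
      rw [hpow, ← add_one_mul] at h
      exact eq_neg_of_add_eq_zero_left ((mul_eq_zero.1 h).resolve_right hy)
    obtain ⟨v, hv⟩ := AddChar.ne_one_iff.1 (hψ hne)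
    rw [AddChar.mulShift_apply] at hv
    have hu : (v + v ^ r) ^ r = v + v ^ r := by rw [hadd, hrr, add_comm]
    have hψu : ψ (y * (v + v ^ r)) ≠ 1 := by
      convert hv using 1
      rw [mul_add, add_mul, AddChar.map_add_eq_mul, AddChar.map_add_eq_mul, ← hψr (y * v ^ r),
        mul_pow, hrr, mul_comm]
    have hsplit : univ.filter (fun t : F => t ^ r = t)
        = insert 0 (univ.filter (fun t : F => t ^ (r - 1) = 1)) := by
      ext t
      simp only [mem_filter, mem_univ, true_and, mem_insert]
      by_cases ht : t = 0
      · simp [ht, (zero_lt_one.trans hr1).ne']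
      · rw [hpow, mul_eq_right₀ ht]
        simp [ht]
    have hzero : (0 : F) ∉ univ.filter (fun t : F => t ^ (r - 1) = 1) := by
      simp [zero_pow (Nat.sub_ne_zero_of_lt hr1)]
    have hsum : ∑ t ∈ univ.filter (fun t : F => t ^ r = t), ψ (y * t) = 0 := by
      refine eq_zero_of_mul_eq_self_left hψu ?_
      rw [mul_sum]
      refine Finset.sum_bij' (fun t _ => (v + v ^ r) + t) (fun t _ => t - (v + v ^ r))
        ?_ ?_ ?_ ?_ ?_
      · intro t ht
        simp only [mem_filter, mem_univ, true_and] at ht ⊢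
        rw [hadd, ht, hu]
      · intro t ht
        simp only [mem_filter, mem_univ, true_and] at ht ⊢
        rw [sub_eq_add_neg, hadd, hr.neg_pow, ht, hu]
      · intro t _; ring
      · intro t _; ring
      · intro t _; rw [mul_add y _ t, AddChar.map_add_eq_mul]
    rw [hsplit, sum_insert hzero, mul_zero, AddChar.map_zero_eq_one] at hsum
    linear_combination hsum

/-- Uniform cyclotomy: the Gauss periods of the subgroup of order `f = (r - 1) k` in a field of
order `r ^ 2`, where `k` is an odd divisor of `r + 1`. -/
lemma gauss_period {F : Type*} [Field F] [Fintype F] {ψ : AddChar F ℂ}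
    (hψ : ψ.IsPrimitive) {r k : ℕ} (hr : Odd r) (hr1 : 1 < r) (hcard : Fintype.card F = r ^ 2)
    (hadd : ∀ x y : F, (x + y) ^ r = x ^ r + y ^ r) (hψr : ∀ x, ψ (x ^ r) = ψ x)
    (h2 : (2 : F) ≠ 0) (hk : Odd k) (hkr : k ∣ r + 1)
    {w : F} (hw : w ^ (r - 1) = -1) {y : F} (hy : y ≠ 0) :
    ∑ c ∈ univ.filter (fun c : F => c ^ ((r - 1) * k) = 1), ψ (y * c)
      = (if y ^ ((r - 1) * k) = -1 then (r : ℂ) else 0) - k := by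
  have hr0 : r - 1 ≠ 0 := Nat.sub_ne_zero_of_lt hr1
  have hk0 : k ≠ 0 := hk.pos.ne'
  have hrc : ((r - 1 : ℕ) : ℂ) ≠ 0 := Nat.cast_ne_zero.2 hr0
  have hdvd : r - 1 ∣ Fintype.card F - 1 :=
    ⟨r + 1, by rw [hcard, mul_comm, ← Nat.sq_sub_sq, one_pow]⟩
  have hdvd' : (r - 1) * k ∣ Fintype.card F - 1 := by
    rw [hcard, ← one_pow 2, Nat.sq_sub_sq, mul_comm (r + 1)]
    exact Nat.mul_dvd_mul_left _ hkr
  have hw0 : w ≠ 0 := by rintro rfl; simp [zero_pow hr0] at hw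
  have hne : ∀ c ∈ univ.filter (fun c : F => c ^ ((r - 1) * k) = 1), c ≠ 0 := by
    rintro c hc rfl
    simp [hr0, hk0] at hc
  set H := univ.filter (fun c : F => c ^ ((r - 1) * k) = 1) with hH
  set T := univ.filter (fun t : F => t ^ (r - 1) = 1) with hT
  have hinv : ∀ t ∈ T, ∑ c ∈ H, ψ (y * c * t) = ∑ c ∈ H, ψ (y * c) := by
    intro t ht
    simp only [hT, mem_filter, mem_univ, true_and] at ht
    have ht0 : t ≠ 0 := by rintro rfl; simp [hr0] at ht
    have h := sum_pow_eq_pow (n := (r - 1) * k) ht0 (fun x => ψ (y * x))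
    rw [pow_mul t, ht, one_pow] at h
    rw [hH, h]
    exact sum_congr rfl fun c _ => by rw [mul_assoc, mul_comm c]
  have hcount : ∑ c ∈ H, (if (y * c) ^ (r - 1) = -1 then (r : ℂ) else 0)
      = if y ^ ((r - 1) * k) = -1 then ((r - 1 : ℕ) : ℂ) * r else 0 := by
    split_ifs with hy1
    · have h := sum_pow_eq_pow (n := (r - 1) * k) hy
        (fun x => if x ^ (r - 1) = -1 then (r : ℂ) else 0)
      rw [← hH, hy1] at h
      rw [← h, ← sum_filter, filter_filter]
      have hset : univ.filter (fun x : F => x ^ ((r - 1) * k) = -1 ∧ x ^ (r - 1) = -1)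
          = univ.filter (fun x : F => x ^ (r - 1) = w ^ (r - 1)) := by
        ext x
        simp only [mem_filter, mem_univ, true_and, hw, and_iff_right_iff_imp]
        intro hx
        rw [pow_mul, hx, hk.neg_one_pow]
      rw [hset, sum_const, card_filter_pow_eq_pow hdvd hw0, nsmul_eq_mul]
    · refine sum_eq_zero fun c hc => if_neg fun hyc => hy1 ?_
      simp only [hH, mem_filter, mem_univ, true_and] at hc
      have : (y * c) ^ ((r - 1) * k) = -1 := by rw [pow_mul, hyc, hk.neg_one_pow]
      rwa [mul_pow, hc, mul_one] at this
  refine mul_left_cancel₀ hrc ?_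
  calc ((r - 1 : ℕ) : ℂ) * ∑ c ∈ H, ψ (y * c) = ∑ t ∈ T, ∑ c ∈ H, ψ (y * c * t) := by
        rw [sum_congr rfl hinv, sum_const, card_filter_pow_eq_one hdvd, nsmul_eq_mul]
    _ = ∑ c ∈ H, ∑ t ∈ T, ψ (y * c * t) := sum_comm
    _ = ∑ c ∈ H, ((if (y * c) ^ (r - 1) = -1 then (r : ℂ) else 0) - 1) :=
        sum_congr rfl fun c hc =>
          sum_subfield_units hψ hr hr1 hcard hadd hψr h2 (mul_ne_zero hy (hne c hc))
    _ = _ := by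
        rw [sum_sub_distrib, hcount, sum_const, card_filter_pow_eq_one hdvd', nsmul_eq_mul]
        split_ifs <;> push_cast <;> ring

/-- Convolution of the Gauss periods of `{c | c ^ f = -1}` with the additive character. -/
lemma sum_character_mul_period {F : Type*} [Field F] [Fintype F] {ψ : AddChar F ℂ}
    (hψ : ψ.IsPrimitive) {r k : ℕ} (hr : Odd r) (hr1 : 1 < r) (hcard : Fintype.card F = r ^ 2)
    (hadd : ∀ x y : F, (x + y) ^ r = x ^ r + y ^ r) (hψr : ∀ x, ψ (x ^ r) = ψ x)
    (h2 : (2 : F) ≠ 0) (hk : Odd k) (hkr : k ∣ r + 1)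
    {w : F} (hw : w ^ (r - 1) = -1) (β : F) :
    ∑ α ∈ univ.filter (fun α : F => α ≠ 0), ψ (β * α⁻¹) *
        ∑ c ∈ univ.filter (fun c : F => c ^ ((r - 1) * k) = -1), ψ (-(α * c))
      = (if β ^ ((r - 1) * k) = -1 then (r : ℂ) ^ 2 else 0) - ((r - 1) * k : ℕ) := by
  have hr0 : r - 1 ≠ 0 := Nat.sub_ne_zero_of_lt hr1
  have hk0 : k ≠ 0 := hk.pos.ne'
  have hdvd' : (r - 1) * k ∣ Fintype.card F - 1 := by
    rw [hcard, ← one_pow 2, Nat.sq_sub_sq, mul_comm (r + 1)]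
    exact Nat.mul_dvd_mul_left _ hkr
  have hw0 : w ≠ 0 := by rintro rfl; simp [zero_pow hr0] at hw
  have hwf : w ^ ((r - 1) * k) = -1 := by rw [pow_mul, hw, hk.neg_one_pow]
  have heven : Even ((r - 1) * k) := (Nat.Odd.sub_odd hr odd_one).mul_right k
  have hperiod : ∀ y : F, y ≠ 0 →
      ∑ c ∈ univ.filter (fun c : F => c ^ ((r - 1) * k) = -1), ψ (y * c)
        = (if y ^ ((r - 1) * k) = 1 then (r : ℂ) else 0) - k := by
    intro y hy
    have h := sum_pow_eq_pow (n := (r - 1) * k) hw0 (fun x => ψ (y * x))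
    rw [hwf] at h
    simp only [← mul_assoc] at h
    rw [h, gauss_period hψ hr hr1 hcard hadd hψr h2 hk hkr hw (mul_ne_zero hy hw0),
      mul_pow, hwf]
    simp
  have hinner : ∀ α ∈ univ.filter (fun α : F => α ≠ 0), ψ (β * α⁻¹) *
        ∑ c ∈ univ.filter (fun c : F => c ^ ((r - 1) * k) = -1), ψ (-(α * c))
      = ψ (β * α⁻¹) * (if (α⁻¹) ^ ((r - 1) * k) = 1 then (r : ℂ) else 0)
        - ψ (β * α⁻¹) * k := by
    intro α hα
    simp only [mem_filter, mem_univ, true_and] at hα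
    simp only [← neg_mul]
    rw [hperiod _ (neg_ne_zero.2 hα), heven.neg_pow, mul_sub]
    simp [inv_pow]
  have hswap : ∀ h : F → ℂ, ∑ α ∈ univ.filter (fun α : F => α ≠ 0), h α⁻¹
      = ∑ α ∈ univ.filter (fun α : F => α ≠ 0), h α := fun h =>
    Finset.sum_bij' (fun x _ => x⁻¹) (fun x _ => x⁻¹) (by simp) (by simp) (by simp) (by simp)
      (by simp)
  rw [sum_congr rfl hinner,
    hswap (fun α => ψ (β * α) * (if α ^ ((r - 1) * k) = 1 then (r : ℂ) else 0) - ψ (β * α) * k),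
    sum_sub_distrib, ← sum_mul]
  have hfirst : ∑ α ∈ univ.filter (fun α : F => α ≠ 0),
        ψ (β * α) * (if α ^ ((r - 1) * k) = 1 then (r : ℂ) else 0)
      = (∑ α ∈ univ.filter (fun α : F => α ^ ((r - 1) * k) = 1), ψ (β * α)) * r := by
    simp only [mul_ite, mul_zero]
    rw [← sum_filter, filter_filter, sum_mul]
    refine sum_congr ?_ fun _ _ => rfl
    ext α
    simp only [mem_filter, mem_univ, true_and, and_iff_right_iff_imp]
    rintro h rfl
    simp [hr0, hk0] at h
  have hsecond : ∑ α ∈ univ.filter (fun α : F => α ≠ 0), ψ (β * α)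
      = (if β = 0 then (r : ℂ) ^ 2 else 0) - 1 := by
    have h := AddChar.sum_mulShift β hψ
    rw [← sum_erase_add _ _ (mem_univ 0), zero_mul, AddChar.map_zero_eq_one, hcard,
      ← filter_ne'] at h
    simp only [mul_comm β]
    rw [eq_sub_iff_add_eq, h]
    push_cast
    rfl
  have hrk : (((r - 1) * k : ℕ) : ℂ) = (r - 1) * k := by
    rw [Nat.cast_mul, Nat.cast_sub hr1.le, Nat.cast_one]
  rw [hfirst, hsecond, hrk]
  by_cases hβ : β = 0
  · have hne : ¬ (0 : F) ^ ((r - 1) * k) = -1 := by simp [hr0, hk0]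
    subst hβ
    simp only [zero_mul, AddChar.map_zero_eq_one, sum_const, card_filter_pow_eq_one hdvd', if_true,
      if_neg hne, nsmul_eq_mul, hrk]
    ring
  · rw [gauss_period hψ hr hr1 hcard hadd hψr h2 hk hkr hw hβ, if_neg hβ]
    split_ifs <;> ring

/-- Completing the square: a character sum over `{x | Q x ∈ C}` in terms of the quadratic sums
`∑ x, ψ (α Q(x))`. -/
lemma card_mul_sum_polarForm {F V : Type*} [Field F] [Fintype F] [AddCommGroup V] [Module F V]
    [Fintype V] {ψ : AddChar F ℂ} (hψ : ψ.IsPrimitive) {Q : V → F}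
    (hQ : ∀ (a : F) x, Q (a • x) = a ^ 2 * Q x)
    (hBadd : ∀ x y z, polarForm Q (x + y) z = polarForm Q x z + polarForm Q y z)
    (hBsmul : ∀ (a : F) x y, polarForm Q (a • x) y = a * polarForm Q x y)
    (hBnd : ∀ x, (∀ y, polarForm Q x y = 0) → x = 0) {E : ℂ}
    (hsum : ∀ α : F, α ≠ 0 → ∑ x : V, ψ (α * Q x) = E) (C : Finset F) {b : V} (hb : b ≠ 0) :
    (Fintype.card F : ℂ) * ∑ x ∈ univ.filter (fun x => Q x ∈ C), ψ (polarForm Q b x)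
      = E * ∑ α ∈ univ.filter (fun α : F => α ≠ 0), ψ (-Q b * α⁻¹) * ∑ c ∈ C, ψ (-(α * c)) := by
  have hcomm : ∀ x y, polarForm Q x y = polarForm Q y x := fun x y => by
    simp only [polarForm, add_comm x y]; ring
  have hind : ∀ x, ∑ α, ∑ c ∈ C, ψ (α * (Q x - c))
      = if Q x ∈ C then (Fintype.card F : ℂ) else 0 := by
    intro x
    rw [sum_comm]
    simp only [AddChar.sum_mulShift _ hψ, sub_eq_zero]
    push_cast
    rw [sum_ite_eq]
  have hlin : ∑ x, ψ (polarForm Q b x) = 0 := by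
    obtain ⟨y, hy⟩ : ∃ y, polarForm Q b y ≠ 0 := by
      by_contra! h
      exact hb (hBnd b h)
    obtain ⟨v, hv⟩ := AddChar.ne_one_iff.1 (hψ hy)
    rw [AddChar.mulShift_apply] at hv
    refine eq_zero_of_mul_eq_self_left hv ?_
    rw [mul_sum, ← Equiv.sum_comp (Equiv.addRight (v • y)) (fun x => ψ (polarForm Q b x))]
    refine sum_congr rfl fun x _ => ?_
    rw [Equiv.coe_addRight, hcomm b (x + v • y), hBadd, hBsmul, hcomm y, hcomm x,
      ← AddChar.map_add_eq_mul]
    ring_nf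
  have hquad : ∀ α : F, α ≠ 0 →
      ∑ x, ψ (α * Q x) * ψ (polarForm Q b x) = E * ψ (-Q b * α⁻¹) := by
    intro α hα
    rw [← hsum α hα, sum_mul, ← Equiv.sum_comp (Equiv.addRight (α⁻¹ • b))
      (fun x => ψ (α * Q x) * ψ (-Q b * α⁻¹))]
    refine sum_congr rfl fun x _ => ?_
    rw [← AddChar.map_add_eq_mul, ← AddChar.map_add_eq_mul, Equiv.coe_addRight]
    have h : Q (x + α⁻¹ • b) = Q x + (α⁻¹) ^ 2 * Q b + α⁻¹ * polarForm Q b x := by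
      rw [← hQ, ← hBsmul, hcomm, polarForm]; ring
    rw [h]
    congr 1
    field_simp
    ring
  have hα : ∀ α : F, ∑ x, (∑ c ∈ C, ψ (α * (Q x - c))) * ψ (polarForm Q b x)
      = (∑ x, ψ (α * Q x) * ψ (polarForm Q b x)) * ∑ c ∈ C, ψ (-(α * c)) := by
    intro α
    rw [sum_mul]
    refine sum_congr rfl fun x _ => ?_
    have hc : ∑ c ∈ C, ψ (α * (Q x - c)) = ψ (α * Q x) * ∑ c ∈ C, ψ (-(α * c)) := by
      rw [mul_sum]
      exact sum_congr rfl fun c _ => by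
        rw [← AddChar.map_add_eq_mul, mul_sub, sub_eq_add_neg]
    rw [hc]
    ring
  calc (Fintype.card F : ℂ) * ∑ x ∈ univ.filter (fun x => Q x ∈ C), ψ (polarForm Q b x)
      = ∑ x, (∑ α, ∑ c ∈ C, ψ (α * (Q x - c))) * ψ (polarForm Q b x) := by
        simp only [hind, ite_mul, zero_mul]
        rw [mul_sum, sum_filter]
    _ = ∑ α, ∑ x, (∑ c ∈ C, ψ (α * (Q x - c))) * ψ (polarForm Q b x) := by
        simp only [sum_mul]
        rw [sum_comm]
    _ = ∑ α ∈ univ.filter (fun α : F => α ≠ 0),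
          (∑ x, ψ (α * Q x) * ψ (polarForm Q b x)) * ∑ c ∈ C, ψ (-(α * c)) := by
        rw [sum_filter]
        refine sum_congr rfl fun α _ => ?_
        rw [hα]
        split_ifs with h
        · rfl
        · simp [not_not.1 h, hlin]
    _ = _ := by
        rw [mul_sum]
        refine sum_congr rfl fun α h => ?_
        rw [hquad α (by simpa using h), mul_assoc]

/-- For odd `a` and odd `n`, the quotient of `a ^ n + 1` by `a + 1` is odd. -/
lemma exists_odd_pow_add_one_eq {a n : ℕ} (ha : Odd a) (hn : Odd n) :
    ∃ t, a ^ n + 1 = (a + 1) * t ∧ Odd t := by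
  obtain ⟨d, rfl⟩ : ∃ d, a = d + 1 := ⟨a - 1, (Nat.sub_add_cancel ha.pos).symm⟩
  have hd : Even d := by simpa [Nat.odd_add_one] using ha
  obtain ⟨i, rfl⟩ := hn
  induction i with
  | zero => exact ⟨1, by simp, odd_one⟩
  | succ i ih =>
    obtain ⟨t, ht, ht_odd⟩ := ih
    refine ⟨t + (d + 1) ^ (2 * i + 1) * d, ?_, ht_odd.add_even (hd.mul_left _)⟩
    rw [mul_add (d + 1 + 1), ← ht]
    ring

/-- `psi` as an additive character. -/
def psiChar (p n : ℕ) [Fact p.Prime] : AddChar (GaloisField p n) ℂ :=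
  ZMod.stdAddChar.compAddMonoidHom
    (Algebra.trace (ZMod p) (GaloisField p n)).toAddMonoidHom

lemma psi_eq_psiChar (p n : ℕ) [Fact p.Prime] (x : GaloisField p n) :
    psi p n x = psiChar p n x := by
  have h := ZMod.stdAddChar_coe (N := p)
    ((Algebra.trace (ZMod p) (GaloisField p n) x).val : ℤ)
  simp only [Int.cast_natCast, ZMod.natCast_zmod_val] at h
  simp only [psi, psiChar, AddChar.compAddMonoidHom_apply, LinearMap.toAddMonoidHom_coe]
  exact h.symm

lemma isPrimitive_psiChar (p n : ℕ) [Fact p.Prime] : (psiChar p n).IsPrimitive := by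
  refine AddChar.IsPrimitive.of_ne_one fun h => one_ne_zero (α := GaloisField p n) ?_
  refine (traceForm_nondegenerate (ZMod p) (GaloisField p n)).1 1 fun x => ?_
  have hx : psiChar p n x = 1 := by rw [h, AddChar.one_apply]
  rw [Algebra.traceForm_apply, one_mul]
  apply ZMod.injective_stdAddChar (N := p)
  rw [AddChar.map_zero_eq_one]
  exact hx

lemma psiChar_pow (p n s : ℕ) [Fact p.Prime] (x : GaloisField p n) :
    psiChar p n (x ^ p ^ s) = psiChar p n x := by
  induction s with
  | zero => simp
  | succ s ih =>
    rw [pow_succ, pow_mul, ← ih]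
    have h := Algebra.trace_eq_of_algEquiv
      (FiniteField.frobeniusAlgEquiv (ZMod p) (GaloisField p n) p) (x ^ p ^ s)
    rw [FiniteField.frobeniusAlgEquiv_apply, ZMod.card] at h
    simp only [psiChar, AddChar.compAddMonoidHom_apply, LinearMap.toAddMonoidHom_coe, h]

/-- The class `C_{e/2}` consists of the solutions of `x ^ f = -1`. -/
lemma cycClass_half (p n : ℕ) [Fact p.Prime] {g : GaloisField p n}
    (hg : ∀ x : GaloisField p n, x ≠ 0 → ∃ k : ℕ, g ^ k = x) {e f : ℕ}
    (he : Even e) (hef : e * f = Fintype.card (GaloisField p n) - 1)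
    (h1 : (-1 : GaloisField p n) ≠ 1) :
    cycClass p n g e f (e / 2) = univ.filter fun x => x ^ f = -1 := by
  have hpos : 0 < Fintype.card (GaloisField p n) - 1 := Nat.sub_pos_of_lt Fintype.one_lt_card
  have hg0 : g ≠ 0 := by
    rintro rfl
    obtain ⟨k, hk⟩ := hg (-1) (by simp)
    rcases k.eq_zero_or_pos with rfl | hk0
    · exact h1 (by simpa using hk.symm)
    · rw [zero_pow hk0.ne'] at hk
      simp at hk
  have hord : orderOf g = Fintype.card (GaloisField p n) - 1 := by
    have hgen : ∀ u : (GaloisField p n)ˣ, u ∈ Subgroup.zpowers (Units.mk0 g hg0) := by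
      intro u
      obtain ⟨k, hk⟩ := hg u u.ne_zero
      exact ⟨k, Units.ext (by simpa using hk)⟩
    have h := orderOf_eq_card_of_forall_mem_zpowers hgen
    rwa [← orderOf_units, Units.val_mk0, Nat.card_eq_fintype_card, Fintype.card_units] at h
  have hprim : IsPrimitiveRoot g (Fintype.card (GaloisField p n) - 1) :=
    hord ▸ IsPrimitiveRoot.orderOf g
  obtain ⟨d, rfl⟩ := he
  have hd0 : 0 < d := Nat.pos_of_ne_zero (by rintro rfl; simp at hef; omega)
  have hf0 : 0 < f := Nat.pos_of_ne_zero (by rintro rfl; simp at hef; omega)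
  have hdd : (d + d) / 2 = d := by omega
  rw [hdd]
  have hhalf : g ^ (d * f) = -1 := by
    have hsq : (g ^ (d * f)) ^ 2 = 1 := by
      rw [← pow_mul, show d * f * 2 = (d + d) * f by ring, hef, hprim.pow_eq_one]
    rw [sq] at hsq
    refine (mul_self_eq_one_iff.1 hsq).resolve_left ?_
    refine hprim.pow_ne_one_of_pos_of_lt (by positivity) ?_
    rw [← hef, add_mul]
    exact Nat.lt_add_of_pos_left (by positivity)
  have hef1 : g ^ ((d + d) * f) = 1 := by rw [hef, hprim.pow_eq_one]
  ext x
  simp only [cycClass, mem_image, mem_range, mem_filter, mem_univ, true_and]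
  constructor
  · rintro ⟨i, _, rfl⟩
    rw [← pow_mul, show (d + (d + d) * i) * f = d * f + (d + d) * f * i by ring, pow_add, hhalf,
      pow_mul, hef1, one_pow, mul_one]
  · intro hx
    have hx0 : x * (g ^ d)⁻¹ ≠ 0 := by
      refine mul_ne_zero ?_ (inv_ne_zero (pow_ne_zero _ hg0))
      rintro rfl
      rw [zero_pow hf0.ne'] at hx
      simp at hx
    obtain ⟨k, hk⟩ := hg _ hx0
    have hkf : g ^ (k * f) = 1 := by
      rw [pow_mul, hk, mul_pow, hx, inv_pow, ← pow_mul, hhalf]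
      norm_num
    obtain ⟨i, rfl⟩ : d + d ∣ k := by
      have := hprim.dvd_of_pow_eq_one _ hkf
      rw [← hef] at this
      exact Nat.dvd_of_mul_dvd_mul_right hf0 this
    refine ⟨i % f, Nat.mod_lt _ hf0, ?_⟩
    have hmod : g ^ ((d + d) * i) = g ^ ((d + d) * (i % f)) := by
      conv_lhs => rw [← Nat.mod_add_div i f]
      rw [mul_add, pow_add, ← mul_assoc, pow_mul g ((d + d) * f), hef1, one_pow, mul_one]
    rw [pow_add, ← hmod, hk]
    field_simp

/-- **Case A character sums.**  With uniform cyclotomy of order `e` on `F_q`, `q = p^{2jγ}`,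
all of `γ, p, (p^j+1)/e` odd (so `e` is even), and `Q` a nonsingular quadratic form on
`V = F_q^{2m}` of type `ε`, the set `D = {x ∈ V : Q(x) ∈ C_{e/2}}` satisfies, for every `b ≠ 0`:
`∑_{x∈D} ψ₁(B(b,x)) = ε q^{m−1}(q−f)` if `−Q(b) ∈ C_{e/2}`, and `= −ε q^{m−1} f` otherwise. -/
theorem character_values_case_A
    (p : ℕ) [Fact p.Prime] (e : ℕ) (he : 2 ≤ e)
    (j : ℕ) (hj : 0 < j) (hje : e ∣ p ^ j + 1)
    (hjmin : ∀ j' : ℕ, 0 < j' → e ∣ p ^ j' + 1 → j ≤ j')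
    (γ : ℕ) (hγ : 1 ≤ γ)
    (hoddγ : Odd γ) (hoddp : Odd p) (hoddf : Odd ((p ^ j + 1) / e))
    (g : GaloisField p (2 * j * γ))
    (hg : ∀ x : GaloisField p (2 * j * γ), x ≠ 0 → ∃ k : ℕ, g ^ k = x)
    (m : ℕ) (hm : 1 ≤ m)
    (Q : (Fin (2 * m) → GaloisField p (2 * j * γ)) → GaloisField p (2 * j * γ))
    (hQ : ∀ (a : GaloisField p (2 * j * γ)) x, Q (a • x) = a ^ 2 * Q x)
    (hBadd : ∀ x y z, polarForm Q (x + y) z = polarForm Q x z + polarForm Q y z)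
    (hBsmul : ∀ (a : GaloisField p (2 * j * γ)) x y,
      polarForm Q (a • x) y = a * polarForm Q x y)
    (hBnd : ∀ x, (∀ y, polarForm Q x y = 0) → x = 0)
    (ε : ℤ) (hε : ε = 1 ∨ ε = -1)
    (hsum : ∀ α : GaloisField p (2 * j * γ), α ≠ 0 →
      ∑ x : Fin (2 * m) → GaloisField p (2 * j * γ), psi p (2 * j * γ) (α * Q x)
        = (ε : ℂ) * ((p : ℂ) ^ (2 * j * γ)) ^ m) :
    ∀ b : Fin (2 * m) → GaloisField p (2 * j * γ), b ≠ 0 →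
      (-Q b ∈ cycClass p (2 * j * γ) g e ((p ^ (2 * j * γ) - 1) / e) (e / 2) →
        ∑ x ∈ (Finset.univ.filter fun x =>
            Q x ∈ cycClass p (2 * j * γ) g e ((p ^ (2 * j * γ) - 1) / e) (e / 2)),
            psi p (2 * j * γ) (polarForm Q b x)
          = (ε : ℂ) * ((p : ℂ) ^ (2 * j * γ)) ^ (m - 1)
              * ((p : ℂ) ^ (2 * j * γ) - (((p ^ (2 * j * γ) - 1) / e : ℕ) : ℂ))) ∧
      (-Q b ∉ cycClass p (2 * j * γ) g e ((p ^ (2 * j * γ) - 1) / e) (e / 2) →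
        ∑ x ∈ (Finset.univ.filter fun x =>
            Q x ∈ cycClass p (2 * j * γ) g e ((p ^ (2 * j * γ) - 1) / e) (e / 2)),
            psi p (2 * j * γ) (polarForm Q b x)
          = -(ε : ℂ) * ((p : ℂ) ^ (2 * j * γ)) ^ (m - 1)
              * (((p ^ (2 * j * γ) - 1) / e : ℕ) : ℂ)) := by
  intro b hb
  have hp : p.Prime := Fact.out
  set n := 2 * j * γ with hn
  have hn0 : n ≠ 0 := by positivity
  have hs0 : j * γ ≠ 0 := by positivity
  obtain ⟨r, hr_def⟩ : ∃ r, r = p ^ (j * γ) := ⟨_, rfl⟩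
  have hq : p ^ n = r ^ 2 := by rw [hr_def, ← pow_mul, hn]; ring_nf
  have hcard : Fintype.card (GaloisField p n) = r ^ 2 := by
    rw [← Nat.card_eq_fintype_card, GaloisField.card p n hn0, hq]
  have hr : Odd r := hr_def ▸ hoddp.pow
  have hr1 : 1 < r := hr_def ▸ Nat.one_lt_pow hs0 hp.one_lt
  have h2 : (2 : GaloisField p n) ≠ 0 := by
    intro h
    have hdvd : p ∣ 2 := (CharP.cast_eq_zero_iff (GaloisField p n) p 2).1 (by exact_mod_cast h)
    rw [(Nat.prime_dvd_prime_iff_eq hp Nat.prime_two).1 hdvd] at hoddp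
    exact absurd hoddp (by decide)
  have h1 : (-1 : GaloisField p n) ≠ 1 := by
    intro h
    apply h2
    linear_combination -h
  have hadd : ∀ x y : GaloisField p n, (x + y) ^ r = x ^ r + y ^ r := fun x y => by
    rw [hr_def, add_pow_char_pow]
  have hψr : ∀ x, psiChar p n (x ^ r) = psiChar p n x := fun x => by rw [hr_def, psiChar_pow]
  obtain ⟨k₀, hk₀⟩ := hje
  rw [hk₀, Nat.mul_div_cancel_left _ (by omega)] at hoddf
  have hpj : Even (p ^ j + 1) := hoddp.pow.add_one
  have heven : Even e := by
    rw [hk₀, Nat.even_mul] at hpj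
    exact hpj.resolve_right (Nat.not_even_iff_odd.2 hoddf)
  obtain ⟨t, ht, ht_odd⟩ := exists_odd_pow_add_one_eq (hoddp.pow (n := j)) hoddγ
  obtain ⟨k, hk, hk_odd⟩ : ∃ k, r + 1 = e * k ∧ Odd k :=
    ⟨k₀ * t, by rw [hr_def, pow_mul, ht, hk₀, mul_assoc], hoddf.mul ht_odd⟩
  have hq1 : r ^ 2 - 1 = e * ((r - 1) * k) := by
    rw [← mul_assoc, mul_right_comm, ← hk, ← Nat.sq_sub_sq, one_pow]
  have hf : (p ^ n - 1) / e = (r - 1) * k := by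
    rw [hq, hq1, Nat.mul_div_cancel_left _ (by omega)]
  obtain ⟨w, hw⟩ : ∃ w : GaloisField p n, w ^ (r - 1) = -1 := by
    refine exists_pow_eq_neg_one (by omega) ?_
    rw [hcard, ← one_pow 2, Nat.sq_sub_sq, mul_comm]
    exact Nat.mul_dvd_mul_right hr.add_one.two_dvd _
  have hcyc := cycClass_half p n hg heven (f := (r - 1) * k) (by rw [hcard, hq1]) h1
  have hqC : (p : ℂ) ^ n = (r : ℂ) ^ 2 := by exact_mod_cast hq
  have hrC : (r : ℂ) ≠ 0 := by
    rw [Nat.cast_ne_zero]; omega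
  simp only [psi_eq_psiChar] at hsum ⊢
  have hmain := card_mul_sum_polarForm (isPrimitive_psiChar p n) hQ hBadd hBsmul hBnd hsum
    (univ.filter fun x : GaloisField p n => x ^ ((r - 1) * k) = -1) hb
  rw [sum_character_mul_period (isPrimitive_psiChar p n) hr hr1 hcard hadd hψr h2 hk_odd
    ⟨e, by rw [hk, mul_comm]⟩ hw, hcard, hqC] at hmain
  obtain ⟨m, rfl⟩ : ∃ m', m = m' + 1 := ⟨m - 1, by omega⟩
  rw [hf, hcyc, hqC, Nat.add_sub_cancel]
  have hr2 : ((r ^ 2 : ℕ) : ℂ) ≠ 0 := by exact_mod_cast pow_ne_zero 2 hrC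
  constructor
  · intro hbC
    rw [mem_filter] at hbC
    rw [if_pos hbC.2] at hmain
    refine mul_left_cancel₀ hr2 (hmain.trans ?_)
    push_cast
    ring
  · intro hbC
    rw [if_neg fun h => hbC (mem_filter.2 ⟨mem_univ _, h⟩)] at hmain
    refine mul_left_cancel₀ hr2 (hmain.trans ?_)
    push_cast
    ring
end
end

section
/- Let p be an odd prime, n ≥ 1, and let f : F_{p^n} → F_p be a weakly regular bent function whose Walsh coefficients satisfy W_f(b) = u G^n ω_p^{f*(b)} for all b ∈ F_{p^n}, where u ∈ {1,−1}, G = ∑_{t∈F_p} ω_p^{t²} is the quadratic Gauss sum, and f* : F_{p^n} → F_p. If there exists a positive integer k with gcd(k−1, p−1) = 1 such that f(tx) = t^k f(x) for all t ∈ F_p and all x ∈ F_{p^n}, then there exists a positive integer ℓ with gcd(ℓ−1, p−1) = 1 such that f*(tx) = t^ℓ f*(x) for all t ∈ F_p and all x ∈ F_{p^n}. -/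
open Finset

noncomputable section
open scoped Classical

/-- `ω_p^a` for `a ∈ F_p`, where `ω_p = exp(2πi/p)`. -/
def ez (p : ℕ) (a : ZMod p) : ℂ :=
  Complex.exp (2 * Real.pi * Complex.I * (a.val : ℂ) / p)

/-- The Walsh coefficient `W_f(b) = ∑_{x∈F_{p^n}} ω_p^{f(x)+Tr(bx)}`. -/
def walsh (p n : ℕ) [Fact p.Prime] (f : GaloisField p n → ZMod p) (b : GaloisField p n) : ℂ :=
  ∑ x : GaloisField p n,
    ez p (f x + Algebra.trace (ZMod p) (GaloisField p n) (b * x))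

/-- The quadratic Gauss sum `G = ∑_{t∈F_p} ω_p^{t²}`. -/
def gaussSum' (p : ℕ) [NeZero p] : ℂ := ∑ t : ZMod p, ez p (t ^ 2)

open Polynomial in
lemma aeval_eq_zero_of_isPrimitiveRoot {K : Type*} [Field K] [CharZero K] {p : ℕ} [Fact p.Prime]
    {ζ ξ : K} (hζ : IsPrimitiveRoot ζ p) (hξ : IsPrimitiveRoot ξ p) {P : ℤ[X]}
    (h : aeval ζ P = 0) : aeval ξ P = 0 := by
  have hp := (Fact.out : p.Prime).pos
  have hdvd := minpoly.isIntegrallyClosed_dvd (hζ.isIntegral hp) h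
  rw [← Polynomial.cyclotomic_eq_minpoly hζ hp,
    Polynomial.cyclotomic_eq_minpoly hξ hp] at hdvd
  obtain ⟨Q, rfl⟩ := hdvd
  simp

lemma ez_eq_pow (p : ℕ) (a : ZMod p) :
    ez p a = Complex.exp (2 * Real.pi * Complex.I / p) ^ a.val := by
  rw [ez, ← Complex.exp_nat_mul]
  congr 1
  ring

lemma ez_pow_val (p : ℕ) [Fact p.Prime] (c a : ZMod p) : ez p c ^ a.val = ez p (c * a) := by
  have h := (Complex.isPrimitiveRoot_exp p (NeZero.ne p)).pow_eq_one
  rw [ez_eq_pow, ez_eq_pow, ← pow_mul, ZMod.val_mul, pow_eq_pow_mod _ h]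

lemma ez_injective (p : ℕ) [Fact p.Prime] : Function.Injective (ez p) := by
  intro a b h
  rw [ez_eq_pow, ez_eq_pow] at h
  exact ZMod.val_injective p ((Complex.isPrimitiveRoot_exp p (NeZero.ne p)).pow_inj
    a.val_lt b.val_lt h)

lemma isPrimitiveRoot_ez (p : ℕ) [Fact p.Prime] {c : ZMod p} (hc : c ≠ 0) :
    IsPrimitiveRoot (ez p c) p := by
  rw [ez_eq_pow]
  refine (Complex.isPrimitiveRoot_exp p (NeZero.ne p)).pow_of_coprime _ ?_
  refine Nat.Coprime.symm (((Fact.out : p.Prime).coprime_iff_not_dvd).2 fun h => ?_)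
  exact hc ((ZMod.val_eq_zero c).1 (Nat.eq_zero_of_dvd_of_lt h c.val_lt))

/-- An identity between character sums of Walsh type is preserved by the Galois substitution
`ω_p ↦ ω_p^c`. -/
lemma sum_ez_mul_eq {V : Type*} [Fintype V] (p : ℕ) [Fact p.Prime] (g : V → ZMod p) (u : ℤ)
    (n : ℕ) (j : ZMod p)
    (h : ∑ x, ez p (g x) = u * (∑ t : ZMod p, ez p (t ^ 2)) ^ n * ez p j)
    {c : ZMod p} (hc : c ≠ 0) :
    ∑ x, ez p (c * g x) = u * (∑ t : ZMod p, ez p (c * t ^ 2)) ^ n * ez p (c * j) := by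
  let P : Polynomial ℤ := ∑ x, Polynomial.X ^ (g x).val -
    Polynomial.C u * (∑ t : ZMod p, Polynomial.X ^ (t ^ 2).val) ^ n * Polynomial.X ^ j.val
  have hP (d : ZMod p) : Polynomial.aeval (ez p d) P = ∑ x, ez p (d * g x) -
      u * (∑ t : ZMod p, ez p (d * t ^ 2)) ^ n * ez p (d * j) := by
    simp [P, ez_pow_val]
  have h1 : Polynomial.aeval (ez p 1) P = 0 := by
    rw [hP]
    simp only [one_mul]
    exact sub_eq_zero.2 h
  have hcP := aeval_eq_zero_of_isPrimitiveRoot (isPrimitiveRoot_ez p one_ne_zero)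
    (isPrimitiveRoot_ez p hc) h1
  rw [hP] at hcP
  exact sub_eq_zero.1 hcP

lemma sum_ez_sq_mul_sq (p : ℕ) [Fact p.Prime] {s : ZMod p} (hs : s ≠ 0) :
    ∑ t : ZMod p, ez p (s ^ 2 * t ^ 2) = ∑ t : ZMod p, ez p (t ^ 2) := by
  refine Fintype.sum_equiv (Equiv.mulLeft₀ s hs) _ _ fun t => ?_
  simp [mul_pow]

/-- The ring of algebraic integers in `ℂ` modulo `2`. -/
abbrev AlgIntModTwo : Type :=
  integralClosure ℤ ℂ ⧸ Ideal.span {(2 : integralClosure ℤ ℂ)}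

/-- Reduction of algebraic integers modulo `2`. -/
abbrev redTwo : integralClosure ℤ ℂ →+* AlgIntModTwo :=
  Ideal.Quotient.mk _

lemma algIntModTwo_two_eq_zero : (2 : AlgIntModTwo) = 0 := by
  have h : redTwo 2 = 0 :=
    Ideal.Quotient.eq_zero_iff_mem.2 (Ideal.mem_span_singleton_self _)
  exact (map_ofNat redTwo 2).symm.trans h

instance : Nontrivial AlgIntModTwo := by
  refine Ideal.Quotient.nontrivial_iff.2 fun h => ?_
  obtain ⟨a, ha⟩ := (Ideal.span_singleton_eq_top.1 h).exists_right_inv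
  have ha' : (2 : ℂ) * a = 1 := congrArg Subtype.val ha
  have hhalf : IsIntegral ℤ (algebraMap ℚ ℂ (1 / 2)) := by
    have : (a : ℂ) = algebraMap ℚ ℂ (1 / 2) := by
      simp only [map_div₀, map_one, map_ofNat]
      linear_combination ha' / 2
    rw [← this]
    exact a.2
  rw [isIntegral_algebraMap_iff (algebraMap ℚ ℂ).injective] at hhalf
  obtain ⟨z, hz⟩ := IsIntegrallyClosed.isIntegral_iff.1 hhalf
  have h2 : (2 * z : ℤ) = 1 := by
    have : (2 * z : ℚ) = 1 := by
      simp only [algebraMap_int_eq, eq_intCast] at hz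
      rw [hz]; norm_num
    exact_mod_cast this
  omega

/-- `ez` as an algebraic integer. -/
def ezInt (p : ℕ) [Fact p.Prime] (a : ZMod p) : integralClosure ℤ ℂ :=
  ⟨ez p a, by
    rw [ez_eq_pow]
    exact ((Complex.isPrimitiveRoot_exp p (NeZero.ne p)).isIntegral
      (Fact.out : p.Prime).pos).pow _⟩

lemma coe_ezInt (p : ℕ) [Fact p.Prime] (a : ZMod p) : (ezInt p a : ℂ) = ez p a := rfl

lemma ezInt_zero (p : ℕ) [Fact p.Prime] : ezInt p 0 = 1 :=
  Subtype.ext (by simp [coe_ezInt, ez_eq_pow])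

lemma redTwo_sum_ezInt_of_even {V : Type*} [Fintype V] [AddGroup V] (p : ℕ) [Fact p.Prime]
    (hV : ∀ x : V, -x = x → x = 0) (g : V → ZMod p) (hg0 : g 0 = 0)
    (hg : ∀ x, g (-x) = g x) : redTwo (∑ x, ezInt p (g x)) = 1 := by
  rw [map_sum, ← Finset.add_sum_erase _ _ (Finset.mem_univ 0), hg0, ezInt_zero, map_one]
  refine add_eq_left.2 (Finset.sum_involution (fun x _ => -x) ?_ ?_ ?_ ?_)
  · intro x _
    rw [hg, ← two_mul, algIntModTwo_two_eq_zero, zero_mul]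
  · intro x hx _ h
    exact (Finset.mem_erase.1 hx).1 (hV x h)
  · intro x hx
    simpa using hx
  · simp

lemma eq_zero_of_redTwo_ezInt_eq_one (p : ℕ) [Fact p.Prime] (hp2 : p ≠ 2) {j : ZMod p}
    (h : redTwo (ezInt p j) = 1) : j = 0 := by
  by_contra hj
  have hsum : ∑ i ∈ Finset.range p, ezInt p j ^ i = 0 := by
    apply Subtype.ext
    have := (isPrimitiveRoot_ez p hj).geom_sum_eq_zero (Fact.out : p.Prime).one_lt
    simpa [coe_ezInt] using this
  have hred := congrArg redTwo hsum
  simp only [map_sum, map_pow, h, one_pow, Finset.sum_const, Finset.card_range, map_zero,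
    nsmul_eq_mul, mul_one] at hred
  obtain ⟨m, hm⟩ := (Fact.out : p.Prime).odd_of_ne_two hp2
  rw [hm] at hred
  push_cast at hred
  rw [algIntModTwo_two_eq_zero, zero_mul, zero_add] at hred
  exact one_ne_zero hred

lemma eq_zero_of_neg_eq_self {K : Type*} [Field K] (h2 : (2 : K) ≠ 0) (x : K) (h : -x = x) :
    x = 0 := by
  have : 2 * x = 0 := by linear_combination -h
  exact (mul_eq_zero.1 this).resolve_left h2

lemma ringChar_two_ne_zero (p : ℕ) [Fact p.Prime] (hp2 : p ≠ 2) (K : Type*) [Field K]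
    [CharP K p] : (2 : K) ≠ 0 :=
  Ring.two_ne_zero (by rwa [ringChar.eq K p])

lemma redTwo_sum_ezInt_sq (p : ℕ) [Fact p.Prime] (hp2 : p ≠ 2) :
    redTwo (∑ t : ZMod p, ezInt p (t ^ 2)) = 1 :=
  redTwo_sum_ezInt_of_even p (eq_zero_of_neg_eq_self (ringChar_two_ne_zero p hp2 _)) _ (by simp)
    (by simp)

lemma gaussSum'_ne_zero (p : ℕ) [Fact p.Prime] (hp2 : p ≠ 2) : gaussSum' p ≠ 0 := by
  intro h
  have h0 : ∑ t : ZMod p, ezInt p (t ^ 2) = 0 := by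
    apply Subtype.ext
    simpa [coe_ezInt, gaussSum'] using h
  have h1 := redTwo_sum_ezInt_sq p hp2
  rw [h0, map_zero] at h1
  exact zero_ne_one h1

/-- An even function vanishing at `0` whose exponential sum is `± G^n ω_p^j` has `j = 0`. -/
lemma eq_zero_of_sum_ez_eq {V : Type*} [Fintype V] [AddGroup V] (p : ℕ) [Fact p.Prime]
    (hp2 : p ≠ 2) (hV : ∀ x : V, -x = x → x = 0) (g : V → ZMod p) (hg0 : g 0 = 0)
    (hg : ∀ x, g (-x) = g x) (u : ℤ) (hu : u = 1 ∨ u = -1) (n : ℕ) (j : ZMod p)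
    (h : ∑ x, ez p (g x) = u * gaussSum' p ^ n * ez p j) : j = 0 := by
  have hint : ∑ x, ezInt p (g x) =
      (u : integralClosure ℤ ℂ) * (∑ t : ZMod p, ezInt p (t ^ 2)) ^ n * ezInt p j := by
    apply Subtype.ext
    simpa [coe_ezInt, gaussSum'] using h
  have hu' : (u : AlgIntModTwo) = 1 := by
    rcases hu with rfl | rfl
    · simp
    · push_cast
      linear_combination -algIntModTwo_two_eq_zero
  have hred := congrArg redTwo hint
  rw [redTwo_sum_ezInt_of_even p hV g hg0 hg, map_mul, map_mul, map_pow,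
    redTwo_sum_ezInt_sq p hp2, map_intCast, hu', one_pow, one_mul, one_mul] at hred
  exact eq_zero_of_redTwo_ezInt_eq_one p hp2 hred.symm

lemma even_of_gcd_pred_eq_one {p k : ℕ} (hp : Odd p) (hk : 0 < k)
    (h : Nat.gcd (k - 1) (p - 1) = 1) : Even k := by
  by_contra hk2
  obtain ⟨a, ha⟩ := hp
  obtain ⟨b, hb⟩ := Nat.not_even_iff_odd.1 hk2
  have : 2 ∣ Nat.gcd (k - 1) (p - 1) := Nat.dvd_gcd ⟨b, by omega⟩ ⟨a, by omega⟩
  omega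

lemma dual_smul_pow (p : ℕ) [Fact p.Prime] (hp2 : p ≠ 2) (n : ℕ)
    (f fstar : GaloisField p n → ZMod p) (u : ℤ) (hu : u = 1 ∨ u = -1)
    (hW : ∀ b : GaloisField p n,
      walsh p n f b = (u : ℂ) * gaussSum' p ^ n * ez p (fstar b))
    (k : ℕ) (hk : 0 < k) (hke : Even k)
    (hhom : ∀ (t : ZMod p) (x : GaloisField p n),
      f (algebraMap (ZMod p) (GaloisField p n) t * x) = t ^ k * f x)
    {t : ZMod p} (ht : t ≠ 0) (b : GaloisField p n) :
    fstar (algebraMap (ZMod p) (GaloisField p n) (t ^ (k - 1)) * b) = t ^ k * fstar b := by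
  have hgal := sum_ez_mul_eq p _ u n _ (hW b) (pow_ne_zero k ht)
  have ht' : algebraMap (ZMod p) (GaloisField p n) t ≠ 0 := by simpa using ht
  have hsum : ∑ x, ez p (t ^ k *
      (f x + Algebra.trace (ZMod p) (GaloisField p n) (b * x))) =
      walsh p n f (algebraMap (ZMod p) (GaloisField p n) (t ^ (k - 1)) * b) := by
    refine Fintype.sum_equiv (Equiv.mulLeft₀ _ ht') _ _ fun x => ?_
    simp only [Equiv.mulLeft₀_apply, hhom, mul_add]
    have hx : algebraMap (ZMod p) (GaloisField p n) (t ^ (k - 1)) * b *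
        (algebraMap (ZMod p) (GaloisField p n) t * x) = t ^ k • (b * x) := by
      rw [Algebra.smul_def, ← Nat.sub_add_cancel hk, pow_succ, map_mul, Nat.add_sub_cancel]
      ring
    rw [hx, map_smul, smul_eq_mul]
  obtain ⟨r, hr⟩ := hke
  have hgauss : ∑ s : ZMod p, ez p (t ^ k * s ^ 2) = gaussSum' p := by
    rw [hr, ← two_mul, mul_comm, pow_mul]
    exact sum_ez_sq_mul_sq p (pow_ne_zero r ht)
  rw [hsum, hgauss, hW] at hgal
  have hu0 : (u : ℂ) ≠ 0 := by rcases hu with rfl | rfl <;> simp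
  exact ez_injective p (mul_left_cancel₀
    (mul_ne_zero hu0 (pow_ne_zero n (gaussSum'_ne_zero p hp2))) hgal)

/-- **Lemma 3.1.**  Let `f : F_{p^n} → F_p` be weakly regular bent with
`W_f(b) = u G^n ω_p^{f*(b)}`.  If there is `k` with `gcd(k−1,p−1) = 1` and `f(tx) = t^k f(x)`
for all `t ∈ F_p`, `x ∈ F_{p^n}`, then there is `ℓ` with `gcd(ℓ−1,p−1) = 1` and
`f*(tx) = t^ℓ f*(x)` for all `t ∈ F_p`, `x ∈ F_{p^n}`. -/
theorem dual_bent_homogeneous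
    (p : ℕ) [Fact p.Prime] (hp2 : p ≠ 2) (n : ℕ) (hn : 1 ≤ n)
    (f fstar : GaloisField p n → ZMod p) (u : ℤ) (hu : u = 1 ∨ u = -1)
    (hW : ∀ b : GaloisField p n,
      walsh p n f b = (u : ℂ) * gaussSum' p ^ n * ez p (fstar b))
    (k : ℕ) (hk : 0 < k) (hkgcd : Nat.gcd (k - 1) (p - 1) = 1)
    (hhom : ∀ (t : ZMod p) (x : GaloisField p n),
      f (algebraMap (ZMod p) (GaloisField p n) t * x) = t ^ k * f x) :
    ∃ ℓ : ℕ, 0 < ℓ ∧ Nat.gcd (ℓ - 1) (p - 1) = 1 ∧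
      ∀ (t : ZMod p) (x : GaloisField p n),
        fstar (algebraMap (ZMod p) (GaloisField p n) t * x) = t ^ ℓ * fstar x := by
  have hp : p.Prime := Fact.out
  have hp3 : 2 < p := lt_of_le_of_ne hp.two_le (Ne.symm hp2)
  have hke := even_of_gcd_pred_eq_one (hp.odd_of_ne_two hp2) hk hkgcd
  have hf0 : f 0 = 0 := by
    have := hhom 0 0
    rwa [mul_zero, zero_pow hk.ne', zero_mul] at this
  have hfneg (x : GaloisField p n) : f (-x) = f x := by
    have := hhom (-1) x
    rwa [map_neg, map_one, neg_one_mul, hke.neg_one_pow, one_mul] at this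
  have hstar0 : fstar 0 = 0 := by
    refine eq_zero_of_sum_ez_eq p hp2
      (eq_zero_of_neg_eq_self (ringChar_two_ne_zero p hp2 (GaloisField p n))) f hf0 hfneg u hu n _ ?_
    simpa [walsh] using hW 0
  obtain ⟨m, -, hm⟩ := Nat.exists_mul_mod_eq_one_of_coprime hkgcd (by omega : 1 < p - 1)
  have hm0 : 0 < m := by
    rcases Nat.eq_zero_or_pos m with rfl | h
    · simp at hm
    · exact h
  have hdiv := Nat.div_add_mod ((k - 1) * m) (p - 1)
  rw [hm] at hdiv
  set q := (k - 1) * m / (p - 1)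
  have hkm : k * m = (k - 1) * m + m := by
    rw [← Nat.succ_mul, Nat.succ_eq_add_one, Nat.sub_add_cancel hk]
  refine ⟨k * m, Nat.mul_pos hk hm0, ?_, fun t x => ?_⟩
  · have hl : k * m - 1 = m + (p - 1) * q := by omega
    rw [hl, Nat.gcd_add_mul_left_left]
    have hd : Nat.gcd m (p - 1) ∣ (p - 1) * q + 1 :=
      hdiv ▸ (Nat.gcd_dvd_left m (p - 1)).mul_left (k - 1)
    exact Nat.dvd_one.1 ((Nat.dvd_add_right ((Nat.gcd_dvd_right m (p - 1)).mul_right q)).1 hd)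
  · rcases eq_or_ne t 0 with rfl | ht
    · rw [map_zero, zero_mul, hstar0, zero_pow (Nat.mul_pos hk hm0).ne', zero_mul]
    · have h := dual_smul_pow p hp2 n f fstar u hu hW k hk hke hhom (pow_ne_zero m ht) x
      have hpow : (t ^ m) ^ (k - 1) = t := by
        rw [← pow_mul, mul_comm, ← hdiv, pow_succ, pow_mul, ZMod.pow_card_sub_one_eq_one ht,
          one_pow, one_mul]
      rwa [hpow, ← pow_mul, mul_comm m k] at h
end
end

section
/- Let p be an odd prime, n ≥ 1, and f : F_{p^n} → F_p a weakly regular bent function with W_f(b) = u G^n ω_p^{f*(b)} for all b (u ∈ {1,−1}, G the quadratic Gauss sum), such that f(tx) = t^k f(x) for all t ∈ F_p, x ∈ F_{p^n}, where gcd(k−1,p−1) = 1; let ℓ be such that gcd(ℓ−1,p−1) = 1 and f*(tx) = t^ℓ f*(x) for all t, x. Then in the complex group algebra ℂ[(F_{p^n},+)]: (1) for all s, t ∈ F_p^× with s+t ≠ 0, L_t · L_s = u·(χ_p(tsv))^n·G^n·L_v, where v ∈ F_p^× is the unique element with v^{1−ℓ} = s^{1−ℓ} + t^{1−ℓ} and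 χ_p denotes the Legendre symbol mod p; (2) for all t ∈ F_p^×, L_t · L_{−t} = p^n · [0]; (3) for all a ∈ F_p, ∑_{t∈F_p^×} L_t · L_0 · ω_p^{−at} = (p|D_a| − p^n) · [F_{p^n}]. -/
open Finset

noncomputable section
open scoped Classical

/-- `L_t = ∑_{x∈F_{p^n}} ω_p^{t f(x)} x`, as an element of the group algebra
`ℂ[(F_{p^n},+)]`. -/
def Lelt (p n : ℕ) [Fact p.Prime] (f : GaloisField p n → ZMod p) (t : ZMod p) :
    AddMonoidAlgebra ℂ (GaloisField p n) :=
  ∑ x : GaloisField p n, AddMonoidAlgebra.single x (ez p (t * f x))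

/-! ### The standard additive character and Gauss sums -/

theorem ez_eq_stdAddChar (p : ℕ) [NeZero p] (a : ZMod p) : ez p a = ZMod.stdAddChar a := by
  rw [ZMod.stdAddChar_apply, ZMod.toCircle_apply, ez]

theorem ez_zero (p : ℕ) [NeZero p] : ez p 0 = 1 := by
  rw [ez_eq_stdAddChar, AddChar.map_zero_eq_one]

theorem ez_add (p : ℕ) [NeZero p] (a b : ZMod p) : ez p (a + b) = ez p a * ez p b := by
  simp only [ez_eq_stdAddChar, AddChar.map_add_eq_mul]

theorem ez_mul_eq_pow (p : ℕ) [NeZero p] (t a : ZMod p) : ez p (t * a) = ez p t ^ a.val := by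
  rw [ez_eq_stdAddChar, ez_eq_stdAddChar, ← AddChar.map_nsmul_eq_pow, nsmul_eq_mul,
    ZMod.natCast_zmod_val, mul_comm]

theorem ez_one_pow (p : ℕ) [NeZero p] (a : ZMod p) : ez p 1 ^ a.val = ez p a := by
  rw [← ez_mul_eq_pow, one_mul]

theorem isPrimitiveRoot_ez_one (p : ℕ) [Fact p.Prime] : IsPrimitiveRoot (ez p 1) p := by
  have h := Complex.isPrimitiveRoot_exp p (NeZero.ne p)
  have h1 : (1 : ZMod p).val = 1 := ZMod.val_one p
  simpa [ez, h1] using h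

/-- Integral polynomial relations between `p`-th roots of unity are Galois invariant. -/
theorem aeval_ez_eq_zero (p : ℕ) [Fact p.Prime] {P : Polynomial ℤ}
    (hP : Polynomial.aeval (ez p 1) P = 0) {t : ZMod p} (ht : t ≠ 0) :
    Polynomial.aeval (ez p t) P = 0 := by
  have hζ := isPrimitiveRoot_ez_one p
  have hcop : t.val.Coprime p := by
    refine ((Nat.Prime.coprime_iff_not_dvd Fact.out).2 fun h => ht ?_).symm
    rwa [← ZMod.natCast_eq_zero_iff, ZMod.natCast_zmod_val] at h
  have hmin := hζ.minpoly_eq_pow_coprime hcop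
  rw [ez_one_pow] at hmin
  obtain ⟨Q, rfl⟩ := minpoly.isIntegrallyClosed_dvd (hζ.isIntegral (NeZero.pos p)) hP
  rw [hmin, map_mul, minpoly.aeval, zero_mul]

theorem sum_ez_mul_of_sum_ez {p : ℕ} [Fact p.Prime] {ι : Type*} [Fintype ι] (g : ι → ZMod p)
    (u : ℤ) (n : ℕ) (c : ZMod p)
    (h : ∑ x, ez p (g x) = (u : ℂ) * gaussSum' p ^ n * ez p c) {t : ZMod p} (ht : t ≠ 0) :
    ∑ x, ez p (t * g x) = (u : ℂ) * (∑ y : ZMod p, ez p (t * y ^ 2)) ^ n * ez p (t * c) := by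
  let P : Polynomial ℤ := ∑ x, Polynomial.X ^ (g x).val -
    Polynomial.C u * (∑ y : ZMod p, Polynomial.X ^ (y ^ 2).val) ^ n * Polynomial.X ^ c.val
  have hP (z : ℂ) : Polynomial.aeval z P = ∑ x, z ^ (g x).val -
      (u : ℂ) * (∑ y : ZMod p, z ^ (y ^ 2).val) ^ n * z ^ c.val := by
    simp [P]
  have h0 : Polynomial.aeval (ez p 1) P = 0 := by
    rw [hP]
    simp only [ez_one_pow]
    rw [h, gaussSum', sub_self]
  have ht0 := aeval_ez_eq_zero p h0 ht
  rw [hP, sub_eq_zero] at ht0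
  simpa only [ez_mul_eq_pow] using ht0

theorem sum_addChar_sq {F : Type*} [Field F] [Fintype F] [DecidableEq F] (hF : ringChar F ≠ 2)
    {φ : AddChar F ℂ} (hφ : φ ≠ 1) :
    ∑ y, φ (y ^ 2) = gaussSum ((quadraticChar F).ringHomComp (Int.castRingHom ℂ)) φ := by
  have hfib : ∑ y, φ (y ^ 2) = ∑ a, ∑ y with y ^ 2 = a, φ a :=
    (Finset.sum_fiberwise' univ (fun y : F => y ^ 2) φ).symm
  have hcard (a : F) : ((univ.filter fun y : F => y ^ 2 = a).card : ℂ)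
      = ((quadraticChar F a : ℤ) : ℂ) + 1 := by
    have := quadraticChar_card_sqrts hF a
    rw [Set.toFinset_ofPred] at this
    exact_mod_cast this
  simp only [hfib, sum_const, nsmul_eq_mul, hcard, add_mul, one_mul, sum_add_distrib,
    AddChar.sum_eq_zero_of_ne_one hφ, add_zero]
  rfl

theorem sum_ez_mul_sq {p : ℕ} [Fact p.Prime] (hp2 : p ≠ 2) {t : ZMod p} (ht : t ≠ 0) :
    ∑ y : ZMod p, ez p (t * y ^ 2) = ((quadraticChar (ZMod p) t : ℤ) : ℂ) * gaussSum' p := by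
  have hF : ringChar (ZMod p) ≠ 2 := by rwa [ZMod.ringChar_zmod_n]
  have hprim := ZMod.isPrimitive_stdAddChar p
  have h1 := sum_addChar_sq hF (hprim ht)
  have h2 := sum_addChar_sq hF (φ := ZMod.stdAddChar) (by simpa using hprim one_ne_zero)
  have h3 := gaussSum_mulShift ((quadraticChar (ZMod p)).ringHomComp (Int.castRingHom ℂ))
    ZMod.stdAddChar (Units.mk0 t ht)
  simp only [gaussSum', ez_eq_stdAddChar]
  simp only [AddChar.mulShift_apply] at h1
  rw [h1, h2, ← h3, Units.val_mk0, MulChar.ringHomComp_apply, ← mul_assoc, eq_intCast,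
    ← Int.cast_mul, ← sq, quadraticChar_sq_one ht, Int.cast_one, one_mul]

theorem gaussSum'_sq {p : ℕ} [Fact p.Prime] (hp2 : p ≠ 2) :
    gaussSum' p ^ 2 = ((quadraticChar (ZMod p) (-1) : ℤ) : ℂ) * p := by
  have hF : ringChar (ZMod p) ≠ 2 := by rwa [ZMod.ringChar_zmod_n]
  have hprim := ZMod.isPrimitive_stdAddChar p
  have h2 := sum_addChar_sq hF (φ := ZMod.stdAddChar) (by simpa using hprim one_ne_zero)
  simp only [gaussSum', ez_eq_stdAddChar]
  have hχ : (quadraticChar (ZMod p)).ringHomComp (Int.castRingHom ℂ) ≠ 1 :=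
    (MulChar.ringHomComp_ne_one_iff (RingHom.injective_int _)).2 (quadraticChar_ne_one hF)
  rw [h2, gaussSum_sq hχ ((quadraticChar_isQuadratic (ZMod p)).comp _) hprim, ZMod.card,
    MulChar.ringHomComp_apply, eq_intCast]

/-! ### The Fourier transform on the group algebra -/

/-- The additive character `x ↦ ω_p^{Tr x}` of `F_{p^n}`. -/
def traceChar (p n : ℕ) [Fact p.Prime] : AddChar (GaloisField p n) ℂ :=
  ZMod.stdAddChar.compAddMonoidHom
    (Algebra.trace (ZMod p) (GaloisField p n)).toAddMonoidHom

theorem traceChar_apply (p n : ℕ) [Fact p.Prime] (x : GaloisField p n) :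
    traceChar p n x = ez p (Algebra.trace (ZMod p) (GaloisField p n) x) := by
  rw [ez_eq_stdAddChar]
  rfl

theorem traceChar_isPrimitive (p n : ℕ) [Fact p.Prime] : (traceChar p n).IsPrimitive := by
  refine AddChar.IsPrimitive.of_ne_one fun h => ?_
  obtain ⟨x, hx⟩ := Algebra.trace_surjective (ZMod p) (GaloisField p n) 1
  have h1 : traceChar p n x = 1 := by rw [h, AddChar.one_apply]
  rw [traceChar_apply, hx] at h1
  exact (isPrimitiveRoot_ez_one p).ne_one (Nat.Prime.one_lt Fact.out) h1

/-- The Fourier transform at `b` of an element of the group algebra. -/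
def fourierAt (p n : ℕ) [Fact p.Prime] (b : GaloisField p n) :
    AddMonoidAlgebra ℂ (GaloisField p n) →ₐ[ℂ] ℂ :=
  AddMonoidAlgebra.lift ℂ ℂ _ ((traceChar p n).mulShift b).toMonoidHom

theorem fourierAt_single (p n : ℕ) [Fact p.Prime] (b x : GaloisField p n) (c : ℂ) :
    fourierAt p n b (AddMonoidAlgebra.single x c) = c * traceChar p n (b * x) := by
  rw [fourierAt, AddMonoidAlgebra.lift_single, smul_eq_mul]
  rfl

theorem fourierAt_apply (p n : ℕ) [Fact p.Prime] (b : GaloisField p n)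
    (A : AddMonoidAlgebra ℂ (GaloisField p n)) :
    fourierAt p n b A = ∑ x, A.coeff x * traceChar p n (b * x) := by
  rw [fourierAt, AddMonoidAlgebra.lift_apply, Finsupp.sum_fintype _ _ (by simp)]
  rfl

theorem fourierAt_ext (p n : ℕ) [Fact p.Prime] {A B : AddMonoidAlgebra ℂ (GaloisField p n)}
    (h : ∀ b, fourierAt p n b A = fourierAt p n b B) : A = B := by
  have inv (A : AddMonoidAlgebra ℂ (GaloisField p n)) (y : GaloisField p n) :
      ∑ b, fourierAt p n b A * traceChar p n (b * -y)
        = Fintype.card (GaloisField p n) * A.coeff y := by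
    simp only [fourierAt_apply, sum_mul]
    rw [sum_comm]
    simp only [mul_assoc, ← AddChar.map_add_eq_mul, ← mul_add, ← mul_sum,
      AddChar.sum_mulShift _ (traceChar_isPrimitive p n), ← sub_eq_add_neg, sub_eq_zero]
    simp [mul_comm]
  have hc : (Fintype.card (GaloisField p n) : ℂ) ≠ 0 :=
    Nat.cast_ne_zero.2 Fintype.card_ne_zero
  apply AddMonoidAlgebra.coeff_injective
  ext y
  refine mul_left_cancel₀ hc ?_
  rw [← inv, ← inv]
  simp only [h]

theorem fourierAt_Lelt (p n : ℕ) [Fact p.Prime] (f : GaloisField p n → ZMod p) (t : ZMod p)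
    (b : GaloisField p n) :
    fourierAt p n b (Lelt p n f t) = ∑ x, ez p (t * f x) * traceChar p n (b * x) := by
  simp only [Lelt, map_sum, fourierAt_single]

theorem fourierAt_Lelt_of_ne_zero {p : ℕ} [Fact p.Prime] (hp2 : p ≠ 2) {n : ℕ}
    {f fstar : GaloisField p n → ZMod p} {u : ℤ}
    (hW : ∀ b, walsh p n f b = (u : ℂ) * gaussSum' p ^ n * ez p (fstar b))
    {ℓ : ℕ}
    (hdual : ∀ (t : ZMod p) (x : GaloisField p n),
      fstar (algebraMap (ZMod p) (GaloisField p n) t * x) = t ^ ℓ * fstar x)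
    {t : ZMod p} (ht : t ≠ 0) (b : GaloisField p n) :
    fourierAt p n b (Lelt p n f t) =
      (u : ℂ) * (((quadraticChar (ZMod p) t : ℤ) : ℂ) * gaussSum' p) ^ n *
        ez p (t ^ ((1 : ℤ) - ℓ) * fstar b) := by
  have h := sum_ez_mul_of_sum_ez _ u n _
    (hW (algebraMap (ZMod p) (GaloisField p n) t⁻¹ * b)) ht
  rw [sum_ez_mul_sq hp2 ht, hdual, ← mul_assoc] at h
  rw [zpow_sub₀ ht, zpow_one, zpow_natCast, div_eq_mul_inv, ← inv_pow, ← h, fourierAt_Lelt]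
  refine sum_congr rfl fun x _ => ?_
  rw [traceChar_apply, ← ez_add, mul_assoc, ← Algebra.smul_def, map_smul, smul_eq_mul, mul_add,
    mul_inv_cancel_left₀ ht]

theorem sum_single_mul_sum_single_one {R M : Type*} [CommSemiring R] [AddCommGroup M] [Fintype M]
    (g : M → R) :
    (∑ x, AddMonoidAlgebra.single x (g x)) * ∑ y : M, AddMonoidAlgebra.single y (1 : R) =
      (∑ x, g x) • ∑ y : M, AddMonoidAlgebra.single y (1 : R) := by
  rw [sum_mul, sum_smul]
  refine sum_congr rfl fun x _ => ?_
  simp only [mul_sum, smul_sum, AddMonoidAlgebra.single_mul_single,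
    AddMonoidAlgebra.smul_single, smul_eq_mul, mul_one]
  exact Equiv.sum_comp (Equiv.addLeft x) fun y => AddMonoidAlgebra.single y (g x)

theorem sum_ez_mul_ne_zero (p : ℕ) [Fact p.Prime] (c : ZMod p) :
    ∑ t ∈ univ.filter (fun t : ZMod p => t ≠ 0), ez p (t * c)
      = (if c = 0 then (p : ℂ) else 0) - 1 := by
  have h := AddChar.sum_mulShift c (ZMod.isPrimitive_stdAddChar p)
  simp only [← ez_eq_stdAddChar] at h
  rw [filter_ne', ← add_sum_erase univ _ (mem_univ (0 : ZMod p)), zero_mul, ez_zero] at *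
  rw [eq_sub_iff_add_eq', h, ZMod.card]
  split_ifs <;> simp

/-- **Lemma 3.3.**  Let `f : F_{p^n} → F_p` be weakly regular bent with
`W_f(b) = u G^n ω_p^{f*(b)}`, `f(tx) = t^k f(x)` with `gcd(k−1,p−1)=1`, and let `ℓ` satisfy
`gcd(ℓ−1,p−1)=1` and `f*(tx) = t^ℓ f*(x)`.  Then, in `ℂ[(F_{p^n},+)]`:
(1) for `s,t,s+t ∈ F_p^×`, `L_t L_s = u (tsv|p)^n G^n L_v` where `v^{1−ℓ} = s^{1−ℓ} + t^{1−ℓ}`;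
(2) for `t ∈ F_p^×`, `L_t L_{−t} = p^n·[0]`;
(3) for `a ∈ F_p`, `∑_{t∈F_p^×} L_t L_0 ω_p^{−at} = (p|D_a| − p^n)·[F_{p^n}]`. -/
theorem Lelt_products
    (p : ℕ) [Fact p.Prime] (hp2 : p ≠ 2) (n : ℕ) (hn : 1 ≤ n)
    (f fstar : GaloisField p n → ZMod p) (u : ℤ) (hu : u = 1 ∨ u = -1)
    (hW : ∀ b : GaloisField p n,
      walsh p n f b = (u : ℂ) * gaussSum' p ^ n * ez p (fstar b))
    (k : ℕ) (hk : 0 < k) (hkgcd : Nat.gcd (k - 1) (p - 1) = 1)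
    (hhom : ∀ (t : ZMod p) (x : GaloisField p n),
      f (algebraMap (ZMod p) (GaloisField p n) t * x) = t ^ k * f x)
    (ℓ : ℕ) (hℓ : 0 < ℓ) (hℓgcd : Nat.gcd (ℓ - 1) (p - 1) = 1)
    (hdual : ∀ (t : ZMod p) (x : GaloisField p n),
      fstar (algebraMap (ZMod p) (GaloisField p n) t * x) = t ^ ℓ * fstar x) :
    (∀ s t : ZMod p, s ≠ 0 → t ≠ 0 → s + t ≠ 0 →
      ∀ v : ZMod p, v ≠ 0 →
        v ^ ((1 : ℤ) - ℓ) = s ^ ((1 : ℤ) - ℓ) + t ^ ((1 : ℤ) - ℓ) →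
          Lelt p n f t * Lelt p n f s
            = ((u : ℂ) * ((legendreSym p ((t * s * v).val) : ℤ) : ℂ) ^ n
                * gaussSum' p ^ n) • Lelt p n f v) ∧
    (∀ t : ZMod p, t ≠ 0 →
      Lelt p n f t * Lelt p n f (-t)
        = AddMonoidAlgebra.single (0 : GaloisField p n) ((p : ℂ) ^ n)) ∧
    (∀ a : ZMod p,
      ∑ t ∈ Finset.univ.filter fun t : ZMod p => t ≠ 0,
          ez p (-(a * t)) • (Lelt p n f t * Lelt p n f 0)
        = ((p : ℂ) * ((Finset.univ.filter fun x => f x = a).card : ℂ) - (p : ℂ) ^ n)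
            • ∑ g : GaloisField p n, AddMonoidAlgebra.single g (1 : ℂ)) := by
  have hp := (Fact.out : p.Prime)
  have hFour {t : ZMod p} (ht : t ≠ 0) := fourierAt_Lelt_of_ne_zero hp2 hW hdual ht
  have hu2 : (u : ℂ) * u = 1 := by rcases hu with rfl | rfl <;> norm_num
  have hsq {t : ZMod p} (ht : t ≠ 0) :
      ((quadraticChar (ZMod p) t : ℤ) : ℂ) * ((quadraticChar (ZMod p) t : ℤ) : ℂ) = 1 := by
    rw [← Int.cast_mul, ← sq, quadraticChar_sq_one ht, Int.cast_one]
  refine ⟨fun s t hs ht _ v hv hvst => fourierAt_ext p n fun b => ?_,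
    fun t ht => fourierAt_ext p n fun b => ?_, fun a => ?_⟩
  · have hleg : (legendreSym p ((t * s * v).val) : ℤ) = quadraticChar (ZMod p) t *
        quadraticChar (ZMod p) s * quadraticChar (ZMod p) v := by
      rw [legendreSym, Int.cast_natCast, ZMod.natCast_zmod_val, map_mul, map_mul]
    rw [map_mul, map_smul, hFour ht, hFour hs, hFour hv, hleg, hvst, add_mul, ez_add, smul_eq_mul]
    push_cast
    have h1 : ((quadraticChar (ZMod p) v : ℤ) : ℂ) ^ n *
        ((quadraticChar (ZMod p) v : ℤ) : ℂ) ^ n = 1 := by rw [← mul_pow, hsq hv, one_pow]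
    simp only [mul_pow]
    linear_combination -((u : ℂ) * u * ((quadraticChar (ZMod p) t : ℤ) : ℂ) ^ n *
      ((quadraticChar (ZMod p) s : ℤ) : ℂ) ^ n * gaussSum' p ^ n * gaussSum' p ^ n *
      ez p (s ^ ((1 : ℤ) - ℓ) * fstar b) * ez p (t ^ ((1 : ℤ) - ℓ) * fstar b)) * h1
  · have hodd : Odd ((1 : ℤ) - ℓ) := by
      have h2 : 2 ∣ p - 1 := (hp.even_sub_one hp2).two_dvd
      have h3 : ¬ 2 ∣ ℓ - 1 := fun h => by
        have := Nat.dvd_gcd h h2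
        omega
      rw [Int.odd_iff]
      omega
    rw [map_mul, hFour ht, hFour (neg_ne_zero.2 ht), hodd.neg_zpow, fourierAt_single, mul_zero,
      AddChar.map_zero_eq_one, mul_one]
    have he : ez p (t ^ ((1 : ℤ) - ℓ) * fstar b) * ez p (-t ^ ((1 : ℤ) - ℓ) * fstar b) = 1 := by
      rw [← ez_add, ← add_mul, add_neg_cancel, zero_mul, ez_zero]
    have hG : (((quadraticChar (ZMod p) t : ℤ) : ℂ) * gaussSum' p) *
        (((quadraticChar (ZMod p) (-t) : ℤ) : ℂ) * gaussSum' p) = p := by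
      have hneg : quadraticChar (ZMod p) (-t) =
          quadraticChar (ZMod p) (-1) * quadraticChar (ZMod p) t := by
        rw [← map_mul, neg_one_mul]
      rw [hneg, mul_mul_mul_comm, ← sq (gaussSum' p), gaussSum'_sq hp2]
      push_cast
      rw [mul_left_comm (quadraticChar (ZMod p) t : ℂ), hsq ht, mul_one, ← mul_assoc,
        hsq (neg_ne_zero.2 one_ne_zero), one_mul]
    rw [mul_mul_mul_comm, he, mul_one, mul_mul_mul_comm, hu2, one_mul, ← mul_pow, hG]
  · have hL0 : Lelt p n f 0 = ∑ g : GaloisField p n, AddMonoidAlgebra.single g (1 : ℂ) := by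
      simp only [Lelt, zero_mul, ez_zero]
    have hcard : (Fintype.card (GaloisField p n) : ℂ) = (p : ℂ) ^ n := by
      rw [Fintype.card_eq_nat_card, GaloisField.card p n (by omega), Nat.cast_pow]
    have hscal (t : ZMod p) : ez p (-(a * t)) • (Lelt p n f t * Lelt p n f 0) =
        (∑ x, ez p (t * (f x - a))) • ∑ g : GaloisField p n, AddMonoidAlgebra.single g (1 : ℂ) := by
      rw [hL0, Lelt, sum_single_mul_sum_single_one, smul_smul, mul_sum]
      simp only [← ez_add]
      congr 1
      exact sum_congr rfl fun x _ => congrArg _ (by ring)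
    simp only [hscal]
    rw [← sum_smul, sum_comm]
    simp only [sum_ez_mul_ne_zero, sub_eq_zero]
    rw [sum_sub_distrib, sum_ite, sum_const, sum_const_zero, add_zero, sum_const, card_univ,
      nsmul_eq_mul, nsmul_eq_mul, mul_one, hcard, mul_comm]
end
end
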